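/- Fix n ≥ 2, equal vortex strengths Γ_α = K ≠ 0 for all α, and parameters A, r > 0. Let H = −(K²/4π) Σ_{α≠β} log ‖x_α − x_β‖² (sum over ordered pairs) and G(x₁,…,x_n) = Σ_{α=1}^n A·exp(−(r/2)‖x_α − x_c‖²) with x_c = (1/n) Σ_β x_β the centroid. Then at every pairwise-distinct configuration (x₁,…,x_n) for which all pairwise distances are equal (there exists d > 0 with ‖x_α − x_β‖ = d for all α ≠ β) and all distances to the centroid are equal (there exists ρ ≥ 0 with ‖x_α − x_c‖ = ρ for all α), the Poisson bracket vanishes: {H, G}(x₁,…,x_n) = 0. -/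

import Mathlib

open Real Finset

/-- Point-vortex Poisson bracket with equal strengths `Γ_α = K`. -/
noncomputable def pvBracketEq (n : ℕ) (K : ℝ)
    (F G : (Fin n → ℝ × ℝ) → ℝ) (z : Fin n → ℝ × ℝ) : ℝ :=
  ∑ α, (1 / K) *
    (fderiv ℝ F z (Pi.single α (1, 0)) * fderiv ℝ G z (Pi.single α (0, 1)) -
     fderiv ℝ F z (Pi.single α (0, 1)) * fderiv ℝ G z (Pi.single α (1, 0)))

/-- Centroid `x_c = (1/n) Σ_β x_β` of a configuration. -/
noncomputable def centroid (n : ℕ) (z : Fin n → ℝ × ℝ) : ℝ × ℝ :=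
  ((n : ℝ))⁻¹ • ∑ β, z β

/-- Squared Euclidean norm on `ℝ²`. -/
def sqnorm (p : ℝ × ℝ) : ℝ := p.1 ^ 2 + p.2 ^ 2

/-- The Euclidean pairing with `p ∈ ℝ²`, as a continuous linear functional. -/
noncomputable def dotCLM (p : ℝ × ℝ) : ℝ × ℝ →L[ℝ] ℝ :=
  p.1 • ContinuousLinearMap.fst ℝ ℝ ℝ + p.2 • ContinuousLinearMap.snd ℝ ℝ ℝ

theorem dotCLM_apply (p v : ℝ × ℝ) : dotCLM p v = p.1 * v.1 + p.2 * v.2 := rfl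

theorem hasFDerivAt_sqnorm (p : ℝ × ℝ) : HasFDerivAt sqnorm ((2 : ℝ) • dotCLM p) p := by
  have h := ((hasFDerivAt_fst (𝕜 := ℝ) (p := p)).pow 2).add
    ((hasFDerivAt_snd (𝕜 := ℝ) (p := p)).pow 2)
  refine HasFDerivAt.congr_fderiv h ?_
  ext <;> simp [dotCLM]

theorem hasFDerivAt_log_sqnorm_sub {n : ℕ} (z : Fin n → ℝ × ℝ) (α β : Fin n)
    (h : sqnorm (z α - z β) ≠ 0) :
    HasFDerivAt (fun z : Fin n → ℝ × ℝ => Real.log (sqnorm (z α - z β)))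
      ((sqnorm (z α - z β))⁻¹ • ((2 : ℝ) • dotCLM (z α - z β)).comp
        (ContinuousLinearMap.proj (R := ℝ) (φ := fun _ : Fin n => ℝ × ℝ) α -
          ContinuousLinearMap.proj β)) z :=
  ((hasFDerivAt_sqnorm (z α - z β)).comp (f := fun z : Fin n → ℝ × ℝ => z α - z β) z
    ((hasFDerivAt_apply α z).fun_sub (hasFDerivAt_apply β z))).log h

theorem hasFDerivAt_centroid {n : ℕ} (z : Fin n → ℝ × ℝ) :
    HasFDerivAt (centroid n) ((n : ℝ)⁻¹ •
      ∑ β, ContinuousLinearMap.proj (R := ℝ) (φ := fun _ : Fin n => ℝ × ℝ) β) z :=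
  (HasFDerivAt.fun_sum fun β _ => hasFDerivAt_apply β z).fun_const_smul _

theorem hasFDerivAt_exp_sqnorm_sub_centroid {n : ℕ} (s : ℝ) (z : Fin n → ℝ × ℝ) (α : Fin n) :
    HasFDerivAt (fun z : Fin n → ℝ × ℝ => Real.exp (s * sqnorm (z α - centroid n z)))
      (Real.exp (s * sqnorm (z α - centroid n z)) •
        (s • ((2 : ℝ) • dotCLM (z α - centroid n z)).comp
        (ContinuousLinearMap.proj (R := ℝ) (φ := fun _ : Fin n => ℝ × ℝ) α -
          (n : ℝ)⁻¹ • ∑ β, ContinuousLinearMap.proj β))) z :=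
  (((hasFDerivAt_sqnorm (z α - centroid n z)).comp
    (f := fun z : Fin n → ℝ × ℝ => z α - centroid n z) z
    ((hasFDerivAt_apply α z).fun_sub (hasFDerivAt_centroid z))).const_mul s).exp

theorem sum_dotCLM_sub_sub_mean {n : ℕ} (z v : Fin n → ℝ × ℝ) (hn : n ≠ 0) :
    ∑ α, dotCLM (z α - centroid n z) (v α - (n : ℝ)⁻¹ • ∑ β, v β) =
      ∑ α, dotCLM (z α - centroid n z) (v α) := by
  have hn' : (n : ℝ) ≠ 0 := Nat.cast_ne_zero.mpr hn
  simp only [dotCLM_apply, _root_.centroid, Prod.fst_sub, Prod.snd_sub, Prod.smul_fst, Prod.smul_snd,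
    Prod.fst_sum, Prod.snd_sum, smul_eq_mul, mul_sub, sub_mul, sum_add_distrib, sum_sub_distrib,
    ← sum_mul, mul_assoc, ← mul_sum, sum_const, card_univ, Fintype.card_fin, nsmul_eq_mul]
  field_simp
  ring

theorem sum_sum_dotCLM_sub {n : ℕ} (z v : Fin n → ℝ × ℝ) (hn : n ≠ 0) :
    ∑ α, ∑ β, dotCLM (z α - z β) (v α - v β) =
      2 * n * ∑ α, dotCLM (z α - centroid n z) (v α) := by
  have hn' : (n : ℝ) ≠ 0 := Nat.cast_ne_zero.mpr hn
  simp only [dotCLM_apply, _root_.centroid, Prod.fst_sub, Prod.snd_sub, Prod.smul_fst, Prod.smul_snd,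
    Prod.fst_sum, Prod.snd_sum, smul_eq_mul, mul_sub, sub_mul, sum_add_distrib, sum_sub_distrib,
    ← sum_mul, mul_assoc, ← mul_sum, sum_const, card_univ, Fintype.card_fin, nsmul_eq_mul]
  field_simp
  ring

/-- The bracket vanishes where both differentials are multiples of one linear functional. -/
theorem pvBracketEq_eq_zero_of_proportional {n : ℕ} {K : ℝ} {F G : (Fin n → ℝ × ℝ) → ℝ}
    {z : Fin n → ℝ × ℝ} {a b : ℝ} {ℓ : (Fin n → ℝ × ℝ) → ℝ}
    (hF : ∀ v, fderiv ℝ F z v = a * ℓ v) (hG : ∀ v, fderiv ℝ G z v = b * ℓ v) :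
    pvBracketEq n K F G z = 0 := by
  refine sum_eq_zero fun α _ => ?_
  rw [hF, hF, hG, hG]
  ring

/-- At any pairwise-distinct configuration with all pairwise distances equal
(to some `d > 0`) and all distances to the centroid equal (to some `ρ ≥ 0`),
the Kirchhoff Hamiltonian `H = −(K²/4π) Σ_{α≠β} log ‖x_α − x_β‖²`
Poisson-commutes with the centroid-centered Gaussian rotational stream function
`G = Σ_α A exp(−(r/2)‖x_α − x_c‖²)`. -/
theorem kirchhoff_commutes_with_rotational_on_regular_configs
    (n : ℕ) (hn : 2 ≤ n) (K : ℝ) (hK : K ≠ 0) (A r : ℝ) (hA : 0 < A) (hr : 0 < r) :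
    let H : (Fin n → ℝ × ℝ) → ℝ := fun z =>
      -(K ^ 2 / (4 * π)) * ∑ α, ∑ β ∈ univ.erase α, Real.log (sqnorm (z α - z β))
    let G : (Fin n → ℝ × ℝ) → ℝ :=
      fun z => ∑ α, A * Real.exp (-(r / 2) * sqnorm (z α - centroid n z))
    ∀ z : Fin n → ℝ × ℝ,
      (∀ α β : Fin n, α ≠ β → z α ≠ z β) →
      (∃ d : ℝ, 0 < d ∧ ∀ α β : Fin n, α ≠ β → sqnorm (z α - z β) = d ^ 2) →
      (∃ ρ : ℝ, 0 ≤ ρ ∧ ∀ α : Fin n, sqnorm (z α - centroid n z) = ρ ^ 2) →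
      pvBracketEq n K H G z = 0 := by
  intro H G z _ ⟨d, hd, hdist⟩ ⟨ρ, _, hcent⟩
  have hn0 : n ≠ 0 := by lia
  have hH := (HasFDerivAt.fun_sum (u := univ) fun α _ => HasFDerivAt.fun_sum (u := univ.erase α)
    fun β hβ => hasFDerivAt_log_sqnorm_sub z α β
      (by rw [hdist α β (ne_of_mem_erase hβ).symm]; positivity)).const_mul (-(K ^ 2 / (4 * π)))
  have hG := HasFDerivAt.fun_sum (u := univ) fun α _ =>
    (hasFDerivAt_exp_sqnorm_sub_centroid (-(r / 2)) z α).const_mul A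
  refine pvBracketEq_eq_zero_of_proportional
    (a := -(K ^ 2 / (4 * π)) * ((d ^ 2)⁻¹ * 2 * (2 * n)))
    (b := A * (Real.exp (-(r / 2) * ρ ^ 2) * (-(r / 2) * 2)))
    (ℓ := fun v => ∑ α, dotCLM (z α - centroid n z) (v α)) (fun v => ?_) (fun v => ?_)
  · have hsum (α : Fin n) : ∑ β ∈ univ.erase α,
        (sqnorm (z α - z β))⁻¹ * (2 * dotCLM (z α - z β) (v α - v β)) =
        (d ^ 2)⁻¹ * 2 * ∑ β, dotCLM (z α - z β) (v α - v β) := by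
      rw [← sum_erase univ (a := α) (by simp), mul_sum]
      refine sum_congr rfl fun β hβ => ?_
      rw [hdist α β (ne_of_mem_erase hβ).symm, mul_assoc]
    rw [hH.fderiv, mul_assoc, mul_assoc _ (2 * (n : ℝ)), ← sum_sum_dotCLM_sub z v hn0, mul_sum,
      ← sum_congr rfl fun α _ => hsum α]
    simp only [_root_.sum_apply, smul_apply, ContinuousLinearMap.comp_apply, sub_apply,
      ContinuousLinearMap.proj_apply, smul_eq_mul]
  · rw [hG.fderiv, ← sum_dotCLM_sub_sub_mean z v hn0, mul_sum]
    simp only [hcent, _root_.sum_apply, smul_apply,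
      ContinuousLinearMap.comp_apply, sub_apply,
      ContinuousLinearMap.proj_apply, smul_eq_mul, mul_assoc]
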